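/- arXiv:2001.09123 — 2 statements merged into one kernel-verified Lean document; each statement's English description precedes it below -/
import Mathlib

section
/- Let n ≥ 4 be an even integer such that n−1 is prime. Then (a) for every v ∈ ℝ^n with pairwise distinct coordinates whose coordinates do not sum to 0 and every hyperplane H ⊆ ℝ^n through the origin, |H ∩ S_n·v| ≤ n·(n−2)!; and (b) there exist such a vector v and a hyperplane H through the origin with |H ∩ S_n·v| = n·(n−2)!. In particular, the maximum of |H ∩ S_n·v| over all such v and all hyperplanes H through the origin equals n·(n−2)!. -/
open Module

/-- If an endomorphism strictly raises the weight `f` of every basis vector, then each level set of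
`f` has at most as many elements as the dimension of its kernel. -/
theorem card_level_le_finrank_ker {K V ι : Type*} [Field K] [AddCommGroup V] [Module K V]
    [Fintype ι] (b : Basis ι K V) (T : V →ₗ[K] V) (f : ι → ℝ)
    (hT : ∀ i j, b.repr (T (b i)) j ≠ 0 → f i < f j) (t : ℝ) :
    Fintype.card {i // f i = t} ≤ finrank K (LinearMap.ker T) := by
  classical
  have : Module.Finite K V := .of_basis b
  let L : ({i // t ≤ f i} → K) →ₗ[K] V := Fintype.linearCombination K fun i => b i
  have hL : LinearMap.ker L = ⊥ :=
    LinearMap.ker_eq_bot.2 (b.linearIndependent.comp _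
      Subtype.val_injective).fintypeLinearCombination_injective
  let Φ : ({i // t ≤ f i} → K) →ₗ[K] ({i // t < f i} → K) :=
    LinearMap.pi fun j => (b.coord j) ∘ₗ T ∘ₗ L
  have hΦ : ∀ c ∈ LinearMap.ker Φ, T (L c) = 0 := by
    intro c hc
    refine b.ext_elem fun j => ?_
    by_cases hj : t < f j
    · simpa [Φ] using congrFun (LinearMap.mem_ker.1 hc) ⟨j, hj⟩
    · simp only [L, Fintype.linearCombination_apply, map_sum, map_smul, Finsupp.coe_finsetSum,
        Finset.sum_apply, map_zero, Finsupp.coe_zero, Pi.zero_apply, Finsupp.smul_apply]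
      refine Finset.sum_eq_zero fun i _ => ?_
      have : b.repr (T (b i)) j = 0 := by
        by_contra h
        exact hj (i.2.trans_lt (hT _ _ h))
      simp [this]
  have hker : finrank K (LinearMap.ker Φ) ≤ finrank K (LinearMap.ker T) := by
    refine LinearMap.finrank_le_finrank_of_injective
      (f := (L ∘ₗ (LinearMap.ker Φ).subtype).codRestrict (LinearMap.ker T)
        fun c => hΦ c c.2) ?_
    intro x y hxy
    exact Subtype.ext (LinearMap.ker_eq_bot.1 hL (congrArg Subtype.val hxy))
  have hrange : finrank K (LinearMap.range Φ) ≤ Fintype.card {i // t < f i} := by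
    simpa using Submodule.finrank_le (LinearMap.range Φ)
  have hsum := LinearMap.finrank_range_add_finrank_ker Φ
  have hcard : Fintype.card {i // t ≤ f i} =
      Fintype.card {i // f i = t} + Fintype.card {i // t < f i} := by
    rw [← Fintype.card_subtype_or_disjoint]
    · exact Fintype.card_congr (Equiv.subtypeEquivRight fun i => by
        rw [le_iff_eq_or_lt, eq_comm])
    · refine Pi.disjoint_iff.2 fun i => ?_
      simp only [Prop.disjoint_iff]
      rintro ⟨h1, h2⟩
      exact h2.ne' h1
  rw [finrank_fintype_fun_eq_card] at hsum
  omega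

/-- If `g` permutes the lines of a basis along `π`, and some `s : ι → ZMod p` satisfies
`s (π i) = s i + m` with `m ≠ 0`, then the fixed space of `g` is at most a `p`-th of the space. -/
theorem finrank_ker_sub_one_mul_le {K V ι : Type*} [Field K] [AddCommGroup V] [Module K V]
    [Fintype ι] (b : Basis ι K V) (g : V →ₗ[K] V) (π : ι ≃ ι) (ε : ι → K) (hε : ∀ i, ε i ≠ 0)
    (hg : ∀ i, g (b i) = ε i • b (π i)) {p : ℕ} [Fact p.Prime] (s : ι → ZMod p) (m : ZMod p)
    (hm : m ≠ 0) (hs : ∀ i, s (π i) = s i + m) :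
    finrank K (LinearMap.ker (g - 1)) * p ≤ Fintype.card ι := by
  classical
  have hiter : ∀ (k : ℕ) i, s (π^[k] i) = s i + k * m := by
    intro k i
    induction k with
    | zero => simp
    | succ k ih => rw [Function.iterate_succ_apply', hs, ih]; push_cast; ring
  have hex : ∀ i (c : ZMod p), ∃ k : ℕ, s (π^[k] i) = c := by
    intro i c
    refine ⟨((c - s i) / m).val, ?_⟩
    rw [hiter, ZMod.natCast_zmod_val]
    field_simp
    ring
  have hcoord : ∀ x i, b.repr (g x) (π i) = ε i * b.repr x i := by
    intro x i
    have : (b.coord (π i)) ∘ₗ g = ε i • b.coord i := by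
      refine b.ext fun j => ?_
      by_cases h : j = i <;> simp [hg, h]
    simpa using LinearMap.congr_fun this x
  have hzero : ∀ x ∈ LinearMap.ker (g - 1), (∀ i, s i = 0 → b.repr x i = 0) → x = 0 := by
    intro x hx h0
    have hgx : g x = x := by simpa [sub_eq_zero] using hx
    have hstep : ∀ i, b.repr x i ≠ 0 → b.repr x (π i) ≠ 0 := by
      intro i hi
      have := hcoord x i
      rw [hgx] at this
      rw [this]
      exact mul_ne_zero (hε i) hi
    refine b.ext_elem fun i => ?_
    by_contra hi
    obtain ⟨k, hk⟩ := hex i 0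
    have : ∀ k : ℕ, b.repr x (π^[k] i) ≠ 0 := by
      intro k
      induction k with
      | zero => simpa using hi
      | succ k ih => rw [Function.iterate_succ_apply']; exact hstep _ ih
    exact this k (h0 _ hk)
  have hfib : ∀ c : ZMod p, Fintype.card {i // s i = c} = Fintype.card {i // s i = 0} := by
    have key : ∀ c k, Fintype.card {i // s i = c} = Fintype.card {i // s i = c + (k : ℕ) * m} := by
      intro c k
      refine Fintype.card_congr ((π^k : Equiv.Perm ι).subtypeEquiv fun i => ?_)
      rw [Equiv.Perm.coe_pow, hiter, add_left_inj]
    intro c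
    rw [key c ((0 - c) / m).val, ZMod.natCast_zmod_val]
    have : c + (0 - c) / m * m = 0 := by field_simp; ring
    simp only [this]
  have htot : Fintype.card ι = Fintype.card {i // s i = 0} * p := by
    rw [← Fintype.card_congr (Equiv.sigmaFiberEquiv s), Fintype.card_sigma]
    simp [hfib, mul_comm]
  rw [htot]
  refine Nat.mul_le_mul_right _ ?_
  have : Module.Finite K V := .of_basis b
  let R : LinearMap.ker (g - 1) →ₗ[K] ({i // s i = 0} → K) :=
    LinearMap.pi fun i => b.coord i ∘ₗ (LinearMap.ker (g - 1)).subtype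
  have hR : Function.Injective R := by
    rw [← LinearMap.ker_eq_bot, LinearMap.ker_eq_bot']
    intro x hx
    refine Subtype.ext (hzero x x.2 fun i hi => ?_)
    simpa [R] using congrFun hx ⟨i, hi⟩
  simpa using LinearMap.finrank_le_finrank_of_injective hR

theorem Equiv.Perm.exists_le_and_le_apply {m : ℕ} (σ : Equiv.Perm (Fin m)) (k : Fin m) :
    ∃ i ≤ k, k ≤ σ i := by
  by_contra! h
  have := Finset.card_le_card_of_injOn (s := Finset.Iic k) (t := Finset.Iio k) σ
    (fun i hi => by simpa using h i (by simpa using hi)) σ.injective.injOn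
  simp at this

open Set.powersetCard in
/-- The exterior power of a unitriangular endomorphism is unitriangular for the componentwise
order on sorted tuples. -/
theorem exteriorPower_repr_map_sub_one {K V I : Type*} [Field K] [AddCommGroup V] [Module K V]
    [LinearOrder I] (b : Basis I K V) (g : V →ₗ[K] V) (hdiag : ∀ i, b.repr (g (b i)) i = 1)
    (htri : ∀ i j, b.repr (g (b i)) j ≠ 0 → i ≤ j) (m : ℕ) (A B : Set.powersetCard I m)
    (h : (b.exteriorPower m).repr ((exteriorPower.map m g - 1) (b.exteriorPower m A)) B ≠ 0) :
    A ≠ B ∧ ∀ k, ofFinEmbEquiv.symm A k ≤ ofFinEmbEquiv.symm B k := by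
  have hmap : (b.exteriorPower m).repr (exteriorPower.map m g (b.exteriorPower m A)) B =
      (Matrix.of fun i j => b.repr (g (b (ofFinEmbEquiv.symm A i)))
        (ofFinEmbEquiv.symm B j)).det := by
    rw [exteriorPower.basis_repr_apply, exteriorPower.basis_apply,
      exteriorPower.map_apply_ιMulti_family, exteriorPower.ιMulti_family,
      exteriorPower.ιMultiDual_apply_ιMulti]
    rfl
  have hAB : A ≠ B := by
    rintro rfl
    apply h
    rw [LinearMap.sub_apply, map_sub, Finsupp.sub_apply, hmap, Matrix.det_of_isUpperTriangular]
    · simp [hdiag]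
    · intro i j hij
      by_contra hne
      exact (htri _ _ hne).not_gt ((ofFinEmbEquiv.symm A).strictMono hij)
  refine ⟨hAB, fun k => ?_⟩
  have hdet : (Matrix.of fun i j => b.repr (g (b (ofFinEmbEquiv.symm A i)))
        (ofFinEmbEquiv.symm B j)).det ≠ 0 := by
    rw [← hmap]
    simpa [hAB, Finsupp.single_apply] using h
  rw [Matrix.det_apply] at hdet
  obtain ⟨σ, -, hσ⟩ := Finset.exists_ne_zero_of_sum_ne_zero hdet
  have hσ' : ∀ i, ofFinEmbEquiv.symm A (σ i) ≤ ofFinEmbEquiv.symm B i := by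
    intro i
    refine htri _ _ fun h0 => hσ ?_
    rw [Finset.prod_eq_zero (Finset.mem_univ i) (by simpa using h0), smul_zero]
  obtain ⟨i, hik, hki⟩ := σ.exists_le_and_le_apply k
  exact ((ofFinEmbEquiv.symm A).monotone hki).trans ((hσ' i).trans
    ((ofFinEmbEquiv.symm B).monotone hik))

open Set.powersetCard in
/-- An endomorphism permuting a basis permutes, up to sign, the basis of the exterior power. -/
theorem exteriorPower_map_basis_of_perm {K V I : Type*} [Field K] [AddCommGroup V] [Module K V]
    [LinearOrder I] (b : Basis I K V) (g : V →ₗ[K] V) (τ : Equiv.Perm I)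
    (hg : ∀ i, g (b i) = b (τ i)) (m : ℕ) (A : Set.powersetCard I m) :
    ∃ ε : K, ε ≠ 0 ∧ exteriorPower.map m g (b.exteriorPower m A) =
      ε • b.exteriorPower m (map m τ.toEmbedding A) := by
  set A' := map m τ.toEmbedding A
  have hmem : ∀ k, ∃ l, ofFinEmbEquiv.symm A' l = τ (ofFinEmbEquiv.symm A k) := by
    intro k
    have : τ (ofFinEmbEquiv.symm A k) ∈ A' := by
      rw [mem_map_iff_mem_range]
      exact ⟨_, (mem_range_ofFinEmbEquiv_symm_iff_mem A _).1 ⟨k, rfl⟩, rfl⟩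
    exact (mem_range_ofFinEmbEquiv_symm_iff_mem A' _).2 this
  choose σ hσ using hmem
  have hinj : Function.Injective σ := by
    intro k l hkl
    have := hσ k
    rw [hkl, hσ l] at this
    exact ((ofFinEmbEquiv.symm A).injective (τ.injective this)).symm
  let σ' : Equiv.Perm (Fin m) := Equiv.ofBijective σ (Finite.injective_iff_bijective.1 hinj)
  refine ⟨((Equiv.Perm.sign σ' : ℤ) : K), ?_, ?_⟩
  · rcases Int.units_eq_one_or (Equiv.Perm.sign σ') with h | h <;> simp [h]
  · rw [exteriorPower.basis_apply, exteriorPower.basis_apply,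
      exteriorPower.map_apply_ιMulti_family, exteriorPower.ιMulti_family,
      exteriorPower.ιMulti_family]
    have : (g ∘ b) ∘ (ofFinEmbEquiv.symm A) = (b ∘ (ofFinEmbEquiv.symm A')) ∘ σ' := by
      funext k
      simp [σ', hσ, hg]
    rw [this, AlternatingMap.map_perm]
    rcases Int.units_eq_one_or (Equiv.Perm.sign σ') with h | h
    · simp [h]
    · rw [h, Units.neg_smul, one_smul, Units.val_neg, Units.val_one, Int.cast_neg, Int.cast_one]
      exact (neg_one_smul K _).symm

theorem val_finRotate_pow_apply {n : ℕ} (k : ℕ) (i : Fin n) :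
    (((finRotate n ^ k) i : Fin n) : ℕ) = (i + k) % n := by
  have := i.neZero
  induction k with
  | zero => simp [Nat.mod_eq_of_lt i.2]
  | succ k ih =>
    rw [pow_succ', Equiv.Perm.mul_apply, finRotate_apply, Fin.val_add, ih, Fin.val_one',
      ← Nat.add_mod, add_assoc]

/-- In characteristic `p`, the cyclic shift of `p` basis vectors is unitriangular in another
basis. -/
theorem exists_basis_unitriangular_of_shift {p : ℕ} [hp : Fact p.Prime] {V : Type*}
    [AddCommGroup V] [Module (ZMod p) V] (e : Basis (Fin p) (ZMod p) V) (g : V →ₗ[ZMod p] V)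
    (hg : ∀ i, g (e i) = e (finRotate p i)) :
    ∃ b : Basis (Fin p) (ZMod p) V, (∀ i, b.repr (g (b i)) i = 1) ∧
      ∀ i j, b.repr (g (b i)) j ≠ 0 → i ≤ j := by
  have : NeZero p := ⟨hp.out.ne_zero⟩
  have : Nontrivial V := ⟨e 0, 0, e.ne_zero 0⟩
  have : Module.Finite (ZMod p) V := .of_basis e
  have : CharP (Module.End (ZMod p) V) p :=
    charP_of_injective_algebraMap (algebraMap (ZMod p) (Module.End (ZMod p) V)).injective p
  have hiter : ∀ (k : ℕ) i, (g ^ k) (e i) = e ((finRotate p ^ k) i) := by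
    intro k i
    induction k with
    | zero => simp
    | succ k ih =>
      rw [pow_succ', Module.End.mul_apply, ih, hg, pow_succ', Equiv.Perm.mul_apply]
  have hrot : finRotate p ^ p = 1 := by
    ext i
    simp [val_finRotate_pow_apply, Nat.mod_eq_of_lt i.2]
  have hgp : (g - 1) ^ p = 0 := by
    rw [sub_pow_char_of_commute p (Commute.one_right g), one_pow, sub_eq_zero]
    refine e.ext fun i => ?_
    rw [hiter, hrot]
    rfl
  let u : Fin p → V := fun j => ((g - 1) ^ (j : ℕ)) (e 0)
  have hu : ∀ j : Fin p, g (u j) = u j + ((g - 1) ^ ((j : ℕ) + 1)) (e 0) := by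
    intro j
    simp [u, pow_succ']
  have hspan : ⊤ ≤ Submodule.span (ZMod p) (Set.range u) := by
    have hnext : ∀ j : Fin p,
        ((g - 1) ^ ((j : ℕ) + 1)) (e 0) ∈ Submodule.span (ZMod p) (Set.range u) := by
      intro j
      by_cases h : (j : ℕ) + 1 < p
      · exact Submodule.subset_span ⟨⟨_, h⟩, rfl⟩
      · rw [show (j : ℕ) + 1 = p by omega, hgp]
        exact Submodule.zero_mem _
    have hinv : Submodule.span (ZMod p) (Set.range u) ≤
        (Submodule.span (ZMod p) (Set.range u)).comap g := by
      rw [Submodule.span_le]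
      rintro _ ⟨j, rfl⟩
      rw [SetLike.mem_coe, Submodule.mem_comap, hu]
      exact Submodule.add_mem _ (Submodule.subset_span ⟨j, rfl⟩) (hnext j)
    have hpow : ∀ k : ℕ, (g ^ k) (e 0) ∈ Submodule.span (ZMod p) (Set.range u) := by
      intro k
      induction k with
      | zero => exact Submodule.subset_span ⟨0, by simp [u]⟩
      | succ k ih => rw [pow_succ', Module.End.mul_apply]; exact hinv ih
    rw [← e.span_eq, Submodule.span_le]
    rintro _ ⟨i, rfl⟩
    have : (finRotate p ^ (i : ℕ)) 0 = i := by
      ext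
      simp [val_finRotate_pow_apply, Nat.mod_eq_of_lt i.2]
    rw [← this, ← hiter]
    exact hpow _
  let b := basisOfTopLeSpanOfCardEqFinrank u hspan (by simp [Module.finrank_eq_card_basis e])
  have hb : ∀ j, b j = u j := fun j => by simp [b]
  have hgb : ∀ i, g (b i) = b i + if h : (i : ℕ) + 1 < p then b ⟨i + 1, h⟩ else 0 := by
    intro i
    rw [hb, hu]
    split_ifs with h
    · rw [hb]
    · rw [show (i : ℕ) + 1 = p by omega, hgp]
      rfl
  refine ⟨b, fun i => ?_, fun i j hij => ?_⟩
  · rw [hgb]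
    split_ifs with h
    · simp [Fin.ext_iff]
    · simp
  · rw [hgb] at hij
    contrapose! hij
    rw [Fin.lt_def] at hij
    have h1 : i ≠ j := fun h => by simp [h] at hij
    split_ifs with h
    · have h2 : (⟨i + 1, h⟩ : Fin p) ≠ j := fun h => by simp [← h] at hij
      simp [h1, h2]
    · simp [h1]

open Set.powersetCard in
/-- For `p` prime, a weighted sum with positive weights over the sorted elements of an `m`-subset of
`p` reals takes each value on at most a `p`-th of all `m`-subsets. -/
theorem card_powersetCard_weighted_sum_eq_mul_le {p : ℕ} [hp : Fact p.Prime] {m : ℕ} (hm : 0 < m)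
    (hmp : m < p) {w : Fin m → ℝ} (hw : ∀ k, 0 < w k) {v : Fin p → ℝ} (hv : StrictMono v) (t : ℝ) :
    Fintype.card {A : Set.powersetCard (Fin p) m //
      ∑ k, w k * v (ofFinEmbEquiv.symm A k) = t} * p ≤
        Fintype.card (Set.powersetCard (Fin p) m) := by
  let e : Basis (Fin p) (ZMod p) (Fin p → ZMod p) := Pi.basisFun (ZMod p) (Fin p)
  let g : (Fin p → ZMod p) →ₗ[ZMod p] (Fin p → ZMod p) :=
    e.constr (ZMod p) fun i => e (finRotate p i)
  have hg : ∀ i, g (e i) = e (finRotate p i) := fun i => e.constr_basis _ _ i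
  obtain ⟨b, hdiag, htri⟩ := exists_basis_unitriangular_of_shift e g hg
  have hlevel := card_level_le_finrank_ker (b.exteriorPower m) (exteriorPower.map m g - 1)
    (fun A => ∑ k, w k * v (ofFinEmbEquiv.symm A k)) (fun A B hAB => by
      obtain ⟨hne, hle⟩ := exteriorPower_repr_map_sub_one b g hdiag htri m A B hAB
      refine Finset.sum_lt_sum
        (fun k _ => mul_le_mul_of_nonneg_left (hv.monotone (hle k)) (hw k).le) ?_
      by_contra! h
      refine hne (ofFinEmbEquiv.symm.injective (RelEmbedding.ext fun k => ?_))
      exact le_antisymm (hle k)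
        (hv.le_iff_le.1 (le_of_mul_le_mul_left (h k (Finset.mem_univ k)) (hw k)))) t
  refine (Nat.mul_le_mul_right p hlevel).trans ?_
  choose ε hε hε' using exteriorPower_map_basis_of_perm e g (finRotate p) hg m
  have hbij : Function.Bijective (map m (finRotate p).toEmbedding) := by
    rw [← Finite.injective_iff_bijective]
    intro A B hAB
    exact Subtype.ext (Finset.map_injective _ (congrArg Subtype.val hAB))
  refine finrank_ker_sub_one_mul_le (e.exteriorPower m) (exteriorPower.map m g)
    (Equiv.ofBijective _ hbij) ε hε hε' (fun A => ∑ i ∈ A.1, ((i : ℕ) : ZMod p)) (m : ZMod p) ?_ ?_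
  · rw [Ne, ZMod.natCast_eq_zero_iff]
    exact Nat.not_dvd_of_pos_of_lt hm hmp
  · intro A
    have : ∀ i : Fin p, ((finRotate p i : ℕ) : ZMod p) = (i : ℕ) + 1 := by
      intro i
      have := val_finRotate_pow_apply 1 i
      rw [pow_one] at this
      rw [this, ZMod.natCast_mod]
      push_cast
      rfl
    simp only [Equiv.ofBijective_apply, val_map, Finset.sum_map, Equiv.coe_toEmbedding, this,
      Finset.sum_add_distrib, Finset.sum_const, nsmul_eq_mul, mul_one, card_eq]

open Set.powersetCard in
/-- A permutation of `I` carrying one `m`-subset onto another, in increasing order. -/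
theorem exists_perm_apply_ofFinEmbEquiv_symm {I : Type*} [LinearOrder I] [Finite I] {m : ℕ}
    (M C : Set.powersetCard I m) :
    ∃ ρ : Equiv.Perm I, (∀ k, ρ (ofFinEmbEquiv.symm M k) = ofFinEmbEquiv.symm C k) ∧
      ∀ i, ρ i ∈ C ↔ i ∈ M := by
  classical
  let e : {x // x ∈ M} ≃ {x // x ∈ C} :=
    ((orderIsoOfFin M).symm.trans (orderIsoOfFin C)).toEquiv
  refine ⟨e.extendSubtype, fun k => ?_, fun i => ⟨fun h => ?_, fun h => ?_⟩⟩
  · have hk : (orderIsoOfFin M k : I) = ofFinEmbEquiv.symm M k := rfl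
    rw [← hk, e.extendSubtype_apply_of_mem _ (orderIsoOfFin M k).2]
    have : e (orderIsoOfFin M k) = orderIsoOfFin C k := by
      simp only [e]
      exact congrArg (orderIsoOfFin C) ((orderIsoOfFin M).symm_apply_apply k)
    exact congrArg Subtype.val this
  · by_contra hi
    exact e.extendSubtype_not_mem i hi h
  · exact e.extendSubtype_mem i h

open Set.powersetCard in
/-- Monotone case of `card_perm_sum_mul_eq_mul_le`. -/
theorem card_perm_sum_mul_eq_mul_le_of_strictMono {p : ℕ} [hp : Fact p.Prime] {a v : Fin p → ℝ}
    (hv : StrictMono v) (ha : ∃ i j, a i ≠ a j) (t : ℝ) :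
    Fintype.card {σ : Equiv.Perm (Fin p) // ∑ i, a i * v (σ i) = t} * p ≤ p.factorial := by
  classical
  have : NeZero p := ⟨hp.out.ne_zero⟩
  have hinv : ∀ (σ : Equiv.Perm (Fin p)) x, σ (σ⁻¹ x) = x := fun σ x => σ.apply_symm_apply x
  obtain ⟨i₀, hi₀⟩ := Finite.exists_min a
  obtain ⟨i₁, hi₁⟩ : ∃ i, a i₀ < a i := by
    by_contra! h
    obtain ⟨i, j, hij⟩ := ha
    exact hij (((h i).antisymm (hi₀ i)).trans ((h j).antisymm (hi₀ j)).symm)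
  let S : Finset (Fin p) := {i | a i₀ < a i}
  have hS : ∀ i, i ∈ S ↔ a i₀ < a i := fun i => by simp [S]
  let M : Set.powersetCard (Fin p) S.card := ⟨S, rfl⟩
  have hM : ∀ i, i ∈ M ↔ a i₀ < a i := hS
  have hm : 0 < S.card := Finset.card_pos.2 ⟨i₁, (hS _).2 hi₁⟩
  have hmp : S.card < p := by
    have := Finset.card_lt_univ_of_notMem (s := S) (x := i₀) (by simp [hS])
    simpa using this
  choose ρ hρ hρM using exists_perm_apply_ofFinEmbEquiv_symm M
  let H := {h : Equiv.Perm (Fin p) // ∀ i, h i ∈ M ↔ i ∈ M}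
  let Φ : H × Set.powersetCard (Fin p) S.card → Equiv.Perm (Fin p) := fun x => ρ x.2 * x.1.1
  have hΦ : Function.Bijective Φ := by
    constructor
    · rintro ⟨h, C⟩ ⟨h', C'⟩ heq
      have hmem : ∀ (h : H) C i, Φ (h, C) i ∈ C ↔ i ∈ M := fun h C i => by
        rw [← h.2 i]
        exact hρM C (h.1 i)
      have hCC : C = C' := by
        refine SetLike.ext fun x => ?_
        obtain ⟨i, rfl⟩ := (Φ (h, C)).surjective x
        rw [hmem, heq, hmem]
      subst hCC
      exact Prod.ext (Subtype.ext (mul_left_cancel heq)) rfl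
    · intro σ
      let C := map S.card σ.toEmbedding M
      refine ⟨(⟨(ρ C)⁻¹ * σ, fun i => ?_⟩, C), by simp [Φ]⟩
      rw [← hρM C, Equiv.Perm.mul_apply, hinv, mem_map_iff_mem_range]
      simp
  have hsum : ∀ (h : H) C, ∑ i, a i * v (Φ (h, C) i) = t ↔
      ∑ k, (a (h.1⁻¹ (ofFinEmbEquiv.symm M k)) - a i₀) * v (ofFinEmbEquiv.symm C k) =
        t - a i₀ * ∑ i, v i := by
    intro h C
    have h1 : ∑ i, (a i - a i₀) * v (Φ (h, C) i) =
        ∑ k, (a (h.1⁻¹ (ofFinEmbEquiv.symm M k)) - a i₀) * v (ofFinEmbEquiv.symm C k) := by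
      have hval : ∀ i, (a i - a i₀) * v (Φ (h, C) i) =
          (fun j => (a (h.1⁻¹ j) - a i₀) * v (ρ C j)) (h.1 i) := by
        intro i
        simp [Φ]
      rw [Finset.sum_congr rfl fun i _ => hval i,
        Equiv.sum_comp h.1 fun j => (a (h.1⁻¹ j) - a i₀) * v (ρ C j)]
      have hout : ∀ j ∉ S, (a (h.1⁻¹ j) - a i₀) * v (ρ C j) = 0 := by
        intro j hj
        have : h.1⁻¹ j ∉ M := by
          rw [← h.2, hinv]
          exact hj
        rw [hM, not_lt] at this
        rw [this.antisymm (hi₀ _), sub_self, zero_mul]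
      rw [← Finset.sum_subset (Finset.subset_univ S) fun j _ hj => hout j hj]
      have hmap := Finset.sum_map Finset.univ (S.orderEmbOfFin rfl).toEmbedding
        fun j => (a (h.1⁻¹ j) - a i₀) * v (ρ C j)
      rw [Finset.map_orderEmbOfFin_univ] at hmap
      refine hmap.trans (Finset.sum_congr rfl fun k _ => ?_)
      rw [← hρ C k]
      rfl
    rw [← h1, ← Equiv.sum_comp (Φ (h, C)) v, Finset.mul_sum, eq_sub_iff_add_eq,
      ← Finset.sum_add_distrib]
    simp [sub_mul]
  have hcard : Fintype.card {σ : Equiv.Perm (Fin p) // ∑ i, a i * v (σ i) = t} =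
      ∑ h : H, Fintype.card {C : Set.powersetCard (Fin p) S.card //
        ∑ k, (a (h.1⁻¹ (ofFinEmbEquiv.symm M k)) - a i₀) * v (ofFinEmbEquiv.symm C k) =
        t - a i₀ * ∑ i, v i} := by
    rw [← Fintype.card_sigma]
    refine (Fintype.card_congr ?_).symm
    refine (Equiv.subtypeProdEquivSigmaSubtype _).symm.trans ?_
    exact (Equiv.ofBijective Φ hΦ).subtypeEquiv fun x => (hsum x.1 x.2).symm
  rw [hcard, Finset.sum_mul]
  refine (Finset.sum_le_sum fun h _ => card_powersetCard_weighted_sum_eq_mul_le hm hmp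
    (fun k => ?_) hv _).trans ?_
  · rw [sub_pos, ← hM, ← h.2, hinv]
    exact (mem_range_ofFinEmbEquiv_symm_iff_mem M _).1 ⟨k, rfl⟩
  · rw [Finset.sum_const, Finset.card_univ, smul_eq_mul, ← Fintype.card_prod,
      Fintype.card_of_bijective hΦ, Fintype.card_perm, Fintype.card_fin]

/-- For `p` prime and `a` nonconstant, the rearrangements `σ` of `p` distinct reals `v` with
`∑ i, a i * v (σ i) = t` make up at most a `p`-th of all permutations. -/
theorem card_perm_sum_mul_eq_mul_le {p : ℕ} [hp : Fact p.Prime] {a v : Fin p → ℝ}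
    (hv : Function.Injective v) (ha : ∃ i j, a i ≠ a j) (t : ℝ) :
    Fintype.card {σ : Equiv.Perm (Fin p) // ∑ i, a i * v (σ i) = t} * p ≤ p.factorial := by
  have hsort : StrictMono (v ∘ Tuple.sort v) :=
    (Tuple.monotone_sort v).strictMono_of_injective (hv.comp (Tuple.sort v).injective)
  refine le_of_eq_of_le ?_ (card_perm_sum_mul_eq_mul_le_of_strictMono hsort ha t)
  congr 1
  refine Fintype.card_congr ((Equiv.mulLeft (Tuple.sort v)⁻¹).subtypeEquiv fun σ => ?_)
  have hσ : ∀ i, (v ∘ Tuple.sort v) (Equiv.mulLeft (Tuple.sort v)⁻¹ σ i) = v (σ i) := fun i =>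
    congrArg v (Equiv.apply_symm_apply _ _)
  simp_rw [hσ]

/-- If `p` is prime, `a : Fin (p + 1) → ℝ` is nonconstant and `v` has distinct coordinates, at most
`(p + 1) * (p - 1)!` rearrangements `σ` satisfy `∑ i, a i * v (σ i) = t`. -/
theorem card_perm_succ_sum_mul_eq_le {p : ℕ} [hp : Fact p.Prime] {a v : Fin (p + 1) → ℝ}
    (hv : Function.Injective v) (ha : ∃ i j, a i ≠ a j) (t : ℝ) :
    Fintype.card {σ : Equiv.Perm (Fin (p + 1)) // ∑ i, a i * v (σ i) = t} ≤
      (p + 1) * (p - 1).factorial := by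
  classical
  have hp0 := hp.out.pos
  have hfac : p.factorial = (p - 1).factorial * p := by
    rw [mul_comm, Nat.mul_factorial_pred hp.out.ne_zero]
  let F (y : Fin (p + 1)) := {e : Equiv.Perm (Fin p) //
    ∑ i : Fin p, a i.succ * v (Equiv.swap 0 y (e i).succ) = t - a 0 * v y}
  have hcard : Fintype.card {σ : Equiv.Perm (Fin (p + 1)) // ∑ i, a i * v (σ i) = t} =
      ∑ y, Fintype.card (F y) := by
    rw [← Fintype.card_sigma]
    refine Fintype.card_congr (Equiv.trans ?_ (Equiv.subtypeProdEquivSigmaSubtype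
      fun y (e : Equiv.Perm (Fin p)) =>
        ∑ i : Fin p, a i.succ * v (Equiv.swap 0 y (e i).succ) = t - a 0 * v y))
    refine (Equiv.Perm.decomposeFin.symm.subtypeEquiv fun x => ?_).symm
    obtain ⟨y, e⟩ := x
    rw [Fin.sum_univ_succ]
    simp only [Equiv.Perm.decomposeFin_symm_apply_zero, Equiv.Perm.decomposeFin_symm_apply_succ]
    rw [eq_sub_iff_add_eq, add_comm]
  rw [hcard]
  by_cases hc : ∃ i j : Fin p, a i.succ ≠ a j.succ
  · have hF : ∀ y, Fintype.card (F y) ≤ (p - 1).factorial := by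
      intro y
      have hinj : Function.Injective fun i : Fin p => v (Equiv.swap 0 y i.succ) :=
        hv.comp ((Equiv.swap 0 y).injective.comp (Fin.succ_injective p))
      have := card_perm_sum_mul_eq_mul_le hinj hc (t - a 0 * v y)
      rw [hfac] at this
      exact Nat.le_of_mul_le_mul_right this hp0
    calc ∑ y, Fintype.card (F y) ≤ ∑ _y : Fin (p + 1), (p - 1).factorial :=
          Finset.sum_le_sum fun y _ => hF y
      _ = (p + 1) * (p - 1).factorial := by simp
  · push Not at hc
    have : NeZero p := ⟨hp.out.ne_zero⟩
    obtain ⟨c, hac⟩ : ∃ c, ∀ i : Fin p, a i.succ = c := ⟨_, fun i => hc i 0⟩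
    have ha0 : a 0 ≠ c := by
      rintro h0
      have : ∀ i, a i = c := fun i => Fin.cases h0 hac i
      obtain ⟨i, j, hij⟩ := ha
      exact hij ((this i).trans (this j).symm)
    have hF : ∀ y, Nonempty (F y) → (a 0 - c) * v y = t - c * ∑ i, v i := by
      rintro y ⟨e, he⟩
      have hswap : ∑ i, v i = v y + ∑ i : Fin p, v (Equiv.swap 0 y (e i).succ) := by
        rw [← Equiv.sum_comp (Equiv.swap 0 y), Fin.sum_univ_succ, Equiv.swap_apply_left,
          Equiv.sum_comp e fun i => v (Equiv.swap 0 y i.succ)]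
      simp only [hac, ← Finset.mul_sum] at he
      rw [hswap]
      linear_combination he
    have huniq : ∀ y z, Nonempty (F y) → Nonempty (F z) → y = z := fun y z hy hz =>
      hv (mul_left_cancel₀ (sub_ne_zero.2 ha0) ((hF y hy).trans (hF z hz).symm))
    have hle : ∀ y, Fintype.card (F y) ≤ p.factorial := fun y => by
      have := Fintype.card_subtype_le (fun e : Equiv.Perm (Fin p) =>
        ∑ i : Fin p, a i.succ * v (Equiv.swap 0 y (e i).succ) = t - a 0 * v y)
      rwa [Fintype.card_perm, Fintype.card_fin] at this
    have hsum : ∑ y, Fintype.card (F y) ≤ p.factorial := by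
      by_cases hne : ∃ y, Nonempty (F y)
      · obtain ⟨y, hy⟩ := hne
        rw [Finset.sum_eq_single y]
        · exact hle y
        · intro z _ hz
          rw [Fintype.card_eq_zero_iff, ← not_nonempty_iff]
          exact fun h => hz (huniq z y h hy)
        · simp
      · push Not at hne
        simp
    rw [hfac, mul_comm] at hsum
    exact hsum.trans (Nat.mul_le_mul_right _ p.le_succ)

theorem two_mul_sum_val_fin (n : ℕ) : 2 * ∑ i : Fin n, ((i : ℕ) : ℝ) = n * (n - 1) := by
  induction n with
  | zero => simp
  | succ n ih =>
    rw [Fin.sum_univ_castSucc, mul_add]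
    simp only [Fin.val_castSucc, Fin.val_last]
    rw [ih]
    push_cast
    ring

/-- The coordinates `0, 1, …, n - 1` attain the bound `n * (n - 2)!` for even `n`, since each of
them is matched with a different one by the condition `x + y = n - 1`. -/
theorem exists_le_card_perm_sum_mul_val_eq_zero {q : ℕ} (hq : 0 < q) :
    ∃ a : Fin (2 * q + 2) → ℝ, a ≠ 0 ∧ (2 * q + 2) * (2 * q).factorial ≤
      Fintype.card {σ : Equiv.Perm (Fin (2 * q + 2)) // ∑ i, a i * ((σ i : ℕ) : ℝ) = 0} := by
  classical
  let a : Fin (2 * q + 2) → ℝ := Fin.cons (-q) (Fin.cons (-q) fun _ => 1)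
  have ha : ∀ σ : Equiv.Perm (Fin (2 * q + 2)), σ 1 = (σ 0).rev →
      ∑ i, a i * ((σ i : ℕ) : ℝ) = 0 := by
    intro σ hσ
    have hsum := two_mul_sum_val_fin (2 * q + 2)
    rw [← Equiv.sum_comp σ, Fin.sum_univ_succ, Fin.sum_univ_succ, Fin.succ_zero_eq_one] at hsum
    have hrev : ((σ 1 : ℕ) : ℝ) = 2 * q + 1 - (σ 0 : ℕ) := by
      rw [eq_sub_iff_add_eq, hσ, Fin.val_rev]
      norm_cast
      omega
    rw [Fin.sum_univ_succ, Fin.sum_univ_succ, Fin.succ_zero_eq_one]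
    simp only [a, Fin.cons_zero, Fin.cons_succ, one_mul, ← Fin.succ_zero_eq_one]
    rw [Fin.succ_zero_eq_one, hrev]
    rw [hrev] at hsum
    push_cast at hsum
    linear_combination hsum / 2
  have hpair : ∀ y : Fin (2 * q + 2), ∃ ρ : Equiv.Perm (Fin (2 * q + 2)),
      ρ 0 = y ∧ ρ 1 = y.rev := by
    intro y
    have hy : y ≠ y.rev := by
      rw [Ne, Fin.ext_iff, Fin.val_rev]
      omega
    obtain ⟨ρ, hρ⟩ := Equiv.Perm.exists_extending_pair ![0, 1] ![y, y.rev]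
      (by simp [Function.Injective, Fin.forall_fin_two])
      (by simp [Function.Injective, Fin.forall_fin_two, hy, hy.symm])
    exact ⟨ρ, hρ 0, hρ 1⟩
  choose ρ hρ0 hρ1 using hpair
  let lift₂ (e : Equiv.Perm (Fin (2 * q))) : Equiv.Perm (Fin (2 * q + 2)) :=
    Equiv.Perm.decomposeFin.symm (0, Equiv.Perm.decomposeFin.symm (0, e))
  have hlift0 : ∀ e, lift₂ e 0 = 0 := fun e => by simp [lift₂]
  have hlift1 : ∀ e, lift₂ e 1 = 1 := fun e => by simp [lift₂]
  have hlift : Function.Injective lift₂ := fun e e' h => by simpa [lift₂] using h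
  refine ⟨a, fun h => ?_, ?_⟩
  · have : (q : ℝ) = 0 := by simpa [a] using congrFun h 0
    exact hq.ne' (by exact_mod_cast this)
  · let Ψ : Fin (2 * q + 2) × Equiv.Perm (Fin (2 * q)) →
        {σ : Equiv.Perm (Fin (2 * q + 2)) // ∑ i, a i * ((σ i : ℕ) : ℝ) = 0} :=
      fun x => ⟨ρ x.1 * lift₂ x.2, ha _ (by simp [hlift0, hlift1, hρ0, hρ1])⟩
    have hΨ : Function.Injective Ψ := by
      rintro ⟨y, e⟩ ⟨y', e'⟩ h
      have h1 : ρ y * lift₂ e = ρ y' * lift₂ e' := congrArg Subtype.val h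
      have h2 : y = y' := by simpa [hlift0, hρ0] using Equiv.congr_fun h1 0
      subst h2
      exact Prod.ext rfl (hlift (mul_left_cancel h1))
    simpa [Fintype.card_perm] using Fintype.card_le_of_injective Ψ hΨ

theorem ncard_hyperplane_inter_orbit {n : ℕ} {v : Fin n → ℝ} (hv : Function.Injective v)
    (a : Fin n → ℝ) :
    ({x : Fin n → ℝ | ∑ i, a i * x i = 0} ∩
      {w : Fin n → ℝ | ∃ σ : Equiv.Perm (Fin n), w = fun i => v (σ⁻¹ i)}).ncard =
      Fintype.card {σ : Equiv.Perm (Fin n) // ∑ i, a i * v (σ i) = 0} := by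
  have hinj : Function.Injective fun (σ : Equiv.Perm (Fin n)) i => v (σ i) :=
    fun σ τ h => Equiv.ext fun i => hv (congrFun h i)
  rw [← Nat.card_eq_fintype_card, ← Nat.card_coe_set_eq]
  refine (Nat.card_congr (Equiv.ofBijective
    (fun σ => ⟨fun i => v (σ.1 i), σ.2, σ.1⁻¹, by rw [inv_inv]⟩) ⟨fun σ τ h => ?_, ?_⟩)).symm
  · exact Subtype.ext (hinj (congrArg Subtype.val h))
  · rintro ⟨_, hw, σ, rfl⟩
    exact ⟨⟨σ⁻¹, hw⟩, rfl⟩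

/-- Let `n ≥ 4` be even with `n - 1` prime. Then (a) for every `v ∈ ℝ^n` with
pairwise distinct coordinates not summing to `0` and every hyperplane `H` through the origin,
`|H ∩ Sₙ·v| ≤ n·(n-2)!`; and (b) there exist such a `v` and a hyperplane `H` through the origin
with `|H ∩ Sₙ·v| = n·(n-2)!`. -/
theorem stmt2 (n : ℕ) (hn : 4 ≤ n) (heven : Even n) (hp : (n - 1).Prime) :
    (∀ v : Fin n → ℝ, (∀ i j : Fin n, i ≠ j → v i ≠ v j) → (∑ i, v i ≠ 0) →
      ∀ a : Fin n → ℝ, a ≠ 0 →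
        ({x : Fin n → ℝ | ∑ i, a i * x i = 0} ∩
          {w : Fin n → ℝ | ∃ σ : Equiv.Perm (Fin n), w = fun i => v (σ⁻¹ i)}).ncard
          ≤ n * (n - 2).factorial) ∧
    (∃ v : Fin n → ℝ, (∀ i j : Fin n, i ≠ j → v i ≠ v j) ∧ (∑ i, v i ≠ 0) ∧
      ∃ a : Fin n → ℝ, a ≠ 0 ∧
        ({x : Fin n → ℝ | ∑ i, a i * x i = 0} ∩
          {w : Fin n → ℝ | ∃ σ : Equiv.Perm (Fin n), w = fun i => v (σ⁻¹ i)}).ncard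
          = n * (n - 2).factorial) := by
  have hupper : ∀ v : Fin n → ℝ, Function.Injective v → (∑ i, v i ≠ 0) →
      ∀ a : Fin n → ℝ, a ≠ 0 →
        Fintype.card {σ : Equiv.Perm (Fin n) // ∑ i, a i * v (σ i) = 0} ≤
          n * (n - 2).factorial := by
    obtain ⟨p, rfl⟩ : ∃ p, n = p + 1 := ⟨n - 1, by omega⟩
    intro v hv hsum a ha
    by_cases hc : ∃ i j, a i ≠ a j
    · exact card_perm_succ_sum_mul_eq_le (p := p) (hp := ⟨hp⟩) hv hc 0
    · push Not at hc
      have hac : ∀ i, a i = a 0 := fun i => hc i 0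
      have ha0 : a 0 ≠ 0 := fun h => ha (funext fun i => (hac i).trans h)
      refine le_of_eq_of_le (Fintype.card_eq_zero_iff.2 ⟨fun σ => ?_⟩) (Nat.zero_le _)
      have hσ := σ.2
      rw [Finset.sum_congr rfl fun i _ => by rw [hac i], ← Finset.mul_sum,
        Equiv.sum_comp σ.1 v] at hσ
      exact mul_ne_zero ha0 hsum hσ
  refine ⟨fun v hv hsum a ha => ?_, ?_⟩
  · have hv' : Function.Injective v := fun i j h => by_contra fun hij => hv i j hij h
    rw [ncard_hyperplane_inter_orbit hv']
    exact hupper v hv' hsum a ha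
  · have hv : Function.Injective fun i : Fin n => ((i : ℕ) : ℝ) :=
      Nat.cast_injective.comp Fin.val_injective
    have hsum : ∑ i : Fin n, ((i : ℕ) : ℝ) ≠ 0 := by
      have h := two_mul_sum_val_fin n
      have hn' : (4 : ℝ) ≤ n := by exact_mod_cast hn
      intro h0
      rw [h0] at h
      nlinarith
    obtain ⟨a, ha, hle⟩ : ∃ a : Fin n → ℝ, a ≠ 0 ∧ n * (n - 2).factorial ≤
        Fintype.card {σ : Equiv.Perm (Fin n) // ∑ i, a i * ((σ i : ℕ) : ℝ) = 0} := by
      obtain ⟨q, rfl⟩ : ∃ q, n = 2 * q + 2 := by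
        obtain ⟨r, rfl⟩ := heven
        exact ⟨r - 1, by omega⟩
      exact exists_le_card_perm_sum_mul_val_eq_zero (by omega)
    refine ⟨fun i => (i : ℕ), fun i j hij => hv.ne hij, hsum, a, ha, ?_⟩
    rw [ncard_hyperplane_inter_orbit hv]
    exact (hupper _ hv hsum a ha).antisymm hle
end

section
/- Let n ≥ 3, let v = (1,2,…,n) ∈ ℝ^n, let s = Σ_{i=2}^{n−1} i, and let a = (−s, −s, n+1, n+1, …, n+1) ∈ ℝ^n with H = {x ∈ ℝ^n : Σ_i a_i x_i = 0}. Then every element w of the orbit S_n·v whose first two coordinates satisfy w_1 + w_2 = n+1 lies in H, and the number of such elements w equals (n−1)! when n is odd and n·(n−2)! when n is even. In particular, if n is even then |H ∩ S_n·v| ≥ n·(n−2)!. -/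
open Finset Equiv in
theorem card_perm_apply_zero_eq (m : ℕ) (q : Fin (m + 1)) :
    #{e : Perm (Fin (m + 1)) | e 0 = q} = m.factorial := by
  rw [card_filter, ← Perm.decomposeFin.symm.sum_comp, Fintype.sum_prod_type]
  simp [Perm.decomposeFin_symm_apply_zero, Fintype.card_perm]

open Finset Equiv in
theorem card_perm_apply_one_eq (m : ℕ) (f : Fin (m + 2) → Fin (m + 2)) :
    #{τ : Perm (Fin (m + 2)) | τ 1 = f (τ 0)} = #{p | f p ≠ p} * m.factorial := by
  rw [card_filter, ← Perm.decomposeFin.symm.sum_comp, Fintype.sum_prod_type, card_filter, sum_mul]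
  refine sum_congr rfl fun p _ => ?_
  rw [← card_filter]
  simp only [Perm.decomposeFin_symm_apply_zero, Perm.decomposeFin_symm_apply_one]
  simp_rw [swap_apply_eq_iff]
  by_cases h : f p = p
  · simp [h, Fin.succ_ne_zero]
  · have h' : swap 0 p (f p) ≠ 0 := by
      rw [Ne, swap_apply_eq_iff, swap_apply_left]
      exact h
    obtain ⟨q, hq⟩ := Fin.exists_succ_eq.mpr h'
    simp [← hq, h, card_perm_apply_zero_eq]

open Finset in
theorem card_rev_ne (n : ℕ) : #{p : Fin n | p.rev ≠ p} = if Odd n then n - 1 else n := by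
  split_ifs with h
  · obtain ⟨k, rfl⟩ := h
    have : ({p : Fin (2 * k + 1) | p.rev ≠ p} : Finset _) = univ.erase ⟨k, by omega⟩ := by
      ext p
      simp only [mem_filter, mem_univ, true_and, mem_erase, and_true, Ne, Fin.ext_iff, Fin.val_rev]
      omega
    rw [this, card_erase_of_mem (mem_univ _)]
    simp
  · rw [Nat.not_odd_iff_even] at h
    obtain ⟨k, rfl⟩ := h
    rw [filter_true_of_mem]
    · simp
    · intro p _
      simp only [Ne, Fin.ext_iff, Fin.val_rev]
      omega

theorem sum_Icc_two_sub_one (m : ℕ) :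
    ∑ i ∈ Finset.Icc 2 (m + 1), (i : ℝ) = (m + 2) * (m + 3) / 2 - (m + 3) := by
  induction m with
  | zero => norm_num
  | succ k ih =>
    rw [Finset.sum_Icc_succ_top (by omega), ih]
    push_cast
    ring

theorem sum_fin_val_add_one (n : ℕ) : ∑ i : Fin n, (((i : ℕ) : ℝ) + 1) = n * (n + 1) / 2 := by
  induction n with
  | zero => simp
  | succ k ih =>
    rw [Fin.sum_univ_castSucc]
    simp only [Fin.val_castSucc, ih, Fin.val_last]
    push_cast
    ring


/-- Let `n ≥ 3`, `v = (1,2,…,n)`, `s = ∑_{i=2}^{n-1} i`, and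
`A = (-s, -s, n+1, …, n+1)`, with `H = {x | ∑ i, A i * x i = 0}`. Then every `w` in the orbit
`Sₙ·v` with `w₁ + w₂ = n + 1` lies in `H`; the number of such `w` is `(n-1)!` if `n` is odd and
`n·(n-2)!` if `n` is even; and hence if `n` is even then `|H ∩ Sₙ·v| ≥ n·(n-2)!`. -/
theorem stmt6 (n : ℕ) (hn : 3 ≤ n)
    (v : Fin n → ℝ) (hv : v = fun i : Fin n => ((i : ℕ) : ℝ) + 1)
    (s : ℝ) (hs : s = ∑ i ∈ Finset.Icc 2 (n - 1), (i : ℝ))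
    (A : Fin n → ℝ) (hA : A = fun i : Fin n => if (i : ℕ) < 2 then -s else (n : ℝ) + 1) :
    (∀ w ∈ {w : Fin n → ℝ | ∃ σ : Equiv.Perm (Fin n), w = fun i => v (σ⁻¹ i)},
      w ⟨0, by omega⟩ + w ⟨1, by omega⟩ = (n : ℝ) + 1 → ∑ i, A i * w i = 0) ∧
    ({w : Fin n → ℝ | (∃ σ : Equiv.Perm (Fin n), w = fun i => v (σ⁻¹ i)) ∧
        w ⟨0, by omega⟩ + w ⟨1, by omega⟩ = (n : ℝ) + 1}).ncard
      = (if Odd n then (n - 1).factorial else n * (n - 2).factorial) ∧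
    (Even n → n * (n - 2).factorial ≤
      ({x : Fin n → ℝ | ∑ i, A i * x i = 0} ∩
        {w : Fin n → ℝ | ∃ σ : Equiv.Perm (Fin n), w = fun i => v (σ⁻¹ i)}).ncard) := by
  obtain ⟨m, rfl⟩ : ∃ m, n = m + 2 := ⟨n - 2, by omega⟩
  have mem_hyperplane : ∀ w ∈ {w : Fin (m + 2) → ℝ | ∃ σ : Equiv.Perm (Fin (m + 2)),
      w = fun i => v (σ⁻¹ i)},
      w ⟨0, by omega⟩ + w ⟨1, by omega⟩ = ((m + 2 : ℕ) : ℝ) + 1 → ∑ i, A i * w i = 0 := by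
    rintro w ⟨σ, hw⟩ h
    have hsum : ∑ i, w i = ((m + 2 : ℕ) : ℝ) * ((m + 2 : ℕ) + 1) / 2 := by
      rw [hw, Equiv.sum_comp σ⁻¹ v, hv, sum_fin_val_add_one]
    have hs' : s = (m + 2) * (m + 3) / 2 - (m + 3) := by
      rw [hs, ← sum_Icc_two_sub_one]
      rfl
    have h01 : w 0 + w 1 = ((m + 2 : ℕ) : ℝ) + 1 := h
    rw [Fin.sum_univ_succ, Fin.sum_univ_succ] at hsum ⊢
    simp only [Fin.succ_zero_eq_one] at hsum ⊢
    have hrest : ∑ i : Fin m, A i.succ.succ * w i.succ.succ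
        = (m + 3) * ∑ i : Fin m, w i.succ.succ := by
      rw [Finset.mul_sum]
      refine Finset.sum_congr rfl fun i _ => ?_
      have : ¬ ((i.succ.succ : Fin (m + 2)) : ℕ) < 2 := by simp
      simp only [hA, if_neg this]
      push_cast
      ring
    have hA0 : A 0 = -s := by simp [hA]
    have hA1 : A 1 = -s := by simp [hA]
    rw [hrest, hA0, hA1, hs']
    push_cast at hsum h01
    linear_combination (m + 3 : ℝ) * hsum - ((m + 2) * (m + 3) / 2 : ℝ) * h01
  have orbit_ncard : {w : Fin (m + 2) → ℝ | (∃ σ : Equiv.Perm (Fin (m + 2)),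
        w = fun i => v (σ⁻¹ i)) ∧
        w ⟨0, by omega⟩ + w ⟨1, by omega⟩ = ((m + 2 : ℕ) : ℝ) + 1}.ncard
      = if Odd (m + 2) then (m + 2 - 1).factorial else (m + 2) * (m + 2 - 2).factorial := by
    have hinj : Function.Injective
        fun (τ : Equiv.Perm (Fin (m + 2))) (i : Fin (m + 2)) => v (τ i) := by
      intro τ τ' h
      ext i
      have := congrFun h i
      simpa [hv] using this
    have himage : {w : Fin (m + 2) → ℝ | (∃ σ : Equiv.Perm (Fin (m + 2)),
        w = fun i => v (σ⁻¹ i)) ∧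
        w ⟨0, by omega⟩ + w ⟨1, by omega⟩ = ((m + 2 : ℕ) : ℝ) + 1}
        = (fun (τ : Equiv.Perm (Fin (m + 2))) (i : Fin (m + 2)) => v (τ i)) ''
          ((Finset.univ.filter fun τ : Equiv.Perm (Fin (m + 2)) => τ 1 = (τ 0).rev :
            Finset (Equiv.Perm (Fin (m + 2)))) : Set (Equiv.Perm (Fin (m + 2)))) := by
      have key (τ : Equiv.Perm (Fin (m + 2))) :
          v (τ 0) + v (τ 1) = ((m + 2 : ℕ) : ℝ) + 1 ↔ τ 1 = (τ 0).rev := by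
        have : v (τ 0) + v (τ 1) = (((τ 0 : ℕ) + 1 + ((τ 1 : ℕ) + 1) : ℕ) : ℝ) := by
          simp [hv]
        rw [this, ← Nat.cast_succ, Nat.cast_inj, Fin.ext_iff, Fin.val_rev]
        omega
      ext w
      simp only [Set.mem_ofPred_eq, Set.mem_image, Finset.coe_filter, Finset.mem_univ, true_and]
      constructor
      · rintro ⟨⟨σ, rfl⟩, h⟩
        exact ⟨σ⁻¹, (key σ⁻¹).mp h, rfl⟩
      · rintro ⟨τ, h, rfl⟩
        exact ⟨⟨τ⁻¹, by simp⟩, (key τ).mpr h⟩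
    rw [himage, Set.ncard_image_of_injective _ hinj, Set.ncard_coe_finset,
      card_perm_apply_one_eq m Fin.rev, card_rev_ne]
    split_ifs
    · exact (Nat.factorial_succ m).symm
    · rfl
  refine ⟨mem_hyperplane, orbit_ncard, fun heven => ?_⟩
  rw [if_neg (Nat.not_odd_iff_even.mpr heven)] at orbit_ncard
  rw [← orbit_ncard]
  refine Set.ncard_le_ncard (fun w hw => ⟨mem_hyperplane w hw.1 hw.2, hw.1⟩) ?_
  refine (Set.Finite.subset (Set.finite_range
    fun (σ : Equiv.Perm (Fin (m + 2))) (i : Fin (m + 2)) => v (σ⁻¹ i)) ?_)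
  rintro w ⟨-, σ, rfl⟩
  exact ⟨σ, rfl⟩
end
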